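/- arXiv:0907.0748 — 3 statements merged into one kernel-verified Lean document; each statement's English description precedes it below -/
import Mathlib

section
/- Let N ≥ 2, let G be a connected simple graph on the vertex set Fin N. On a probability space (Ω, P), let (σ_t)_{t∈ℕ} be an i.i.d. sequence of edge-valued random variables with P(σ_t = e) > 0 for every edge e of G, and let (U_t)_{t∈ℕ} be an i.i.d. sequence of random vectors uniformly distributed on [0,1)^N, jointly independent of (σ_t). Define q_p(z, u) = ⌊z⌋ + 1 if u < z − ⌊z⌋, and q_p(z, u) = ⌊z⌋ otherwise. Given x(0) ∈ ℝ^N, define x : ℕ → ℝ^N by: if σ_t = {i, j}, then x_{t+1}(i) = x_t(i) − (1/2)q_p(x_t(i), U_t(i)) + (1/2)q_p(x_t(j), U_t(j)) and x_{t+1}(j) = x_t(j) − (1/2)q_p(x_t(j), U_t(j)) + (1/2)q_p(x_t(i), U_t(i)), while x_{t+1}(h) = x_t(h) for h ∉ {i, j}. Then limsup_{t→∞} √((1/N)·E[∑_i (x_i(t) − x_ave(0))²]) ≤ 1/2, where x_ave(0) = (1/N)∑_i x_i(0). -/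
open MeasureTheory

/-- The probabilistic quantizer realized via a uniform `[0,1)` variable:
`qp z u = ⌊z⌋ + 1` if `u < Int.fract z`, else `⌊z⌋`. -/
noncomputable def qp (z u : ℝ) : ℤ :=
  if u < Int.fract z then ⌊z⌋ + 1 else ⌊z⌋

/-- The uniform probability distribution on the cube `[0,1)^N`. -/
noncomputable def unifCube (N : ℕ) : Measure (Fin N → ℝ) :=
  Measure.pi fun _ => (volume.restrict (Set.Ico (0:ℝ) 1))

open ProbabilityTheory Matrix

/-- The quantization error of the probabilistic quantizer. -/
noncomputable def qpError (z u : ℝ) : ℝ := (qp z u : ℝ) - z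

/-- Transfer of the amount `c` from coordinate `i` to coordinate `j`. -/
noncomputable def transfer {N : ℕ} (i j : Fin N) (c : ℝ) (w : Fin N → ℝ) : Fin N → ℝ :=
  w - c • (Pi.single i 1 - Pi.single j 1)

/-- The compensating gossip update along the pair `(i, j)`. -/
noncomputable def gossipStep {N : ℕ} (i j : Fin N) (x u : Fin N → ℝ) : Fin N → ℝ :=
  transfer i j (((qp (x i) (u i) : ℝ) - (qp (x j) (u j) : ℝ)) / 2) x

theorem measurable_qp : Measurable fun p : ℝ × ℝ => (qp p.1 p.2 : ℝ) := by
  have h : Measurable fun p : ℝ × ℝ => qp p.1 p.2 := by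
    unfold qp
    refine Measurable.ite (measurableSet_lt measurable_snd (measurable_fract.comp measurable_fst))
      ?_ ?_
    · exact (Int.measurable_floor.comp measurable_fst).add_const 1
    · exact Int.measurable_floor.comp measurable_fst
  exact (measurable_from_top (f := fun n : ℤ => (n : ℝ))).comp h

theorem qpError_eq (z u : ℝ) :
    qpError z u = (Set.Iio (Int.fract z)).indicator 1 u - Int.fract z := by
  have := Int.floor_add_fract z
  by_cases h : u < Int.fract z
  · simp [qpError, qp, h]; linarith
  · simp [qpError, qp, h]; linarith

theorem abs_qpError_le (z u : ℝ) : |qpError z u| ≤ 1 := by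
  have h0 := Int.fract_nonneg z
  have h1 := Int.fract_lt_one z
  rw [qpError_eq, abs_le]
  by_cases h : u < Int.fract z
  · simp only [Set.indicator_of_mem (Set.mem_Iio.2 h), Pi.one_apply]
    constructor <;> linarith
  · simp only [Set.indicator_of_notMem (mt Set.mem_Iio.1 h)]
    constructor <;> linarith

theorem measurable_qpError (z : ℝ) : Measurable (qpError z) :=
  (measurable_qp.comp (measurable_const.prodMk measurable_id)).sub_const z

instance isProbabilityMeasure_restrict_Ico :
    IsProbabilityMeasure (volume.restrict (Set.Ico (0 : ℝ) 1)) := ⟨by simp⟩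

instance isProbabilityMeasure_unifCube (N : ℕ) : IsProbabilityMeasure (unifCube N) := by
  unfold unifCube; infer_instance

theorem integral_indicator_Iio_fract (z : ℝ) :
    ∫ u in Set.Ico (0 : ℝ) 1, (Set.Iio (Int.fract z)).indicator (1 : ℝ → ℝ) u = Int.fract z := by
  have h0 := Int.fract_nonneg z
  have h1 := (Int.fract_lt_one z).le
  rw [integral_indicator_one measurableSet_Iio, measureReal_restrict_apply measurableSet_Iio,
    Set.inter_comm, Set.Ico_inter_Iio, min_eq_right h1, Real.volume_real_Ico_of_le h0, sub_zero]

theorem integrable_indicator_Iio (a : ℝ) :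
    Integrable ((Set.Iio a).indicator (1 : ℝ → ℝ)) (volume.restrict (Set.Ico (0 : ℝ) 1)) :=
  (integrable_const (1 : ℝ)).indicator measurableSet_Iio

theorem integral_qpError (z : ℝ) : ∫ u in Set.Ico (0 : ℝ) 1, qpError z u = 0 := by
  simp_rw [qpError_eq]
  rw [integral_sub (integrable_indicator_Iio _) (integrable_const _),
    integral_indicator_Iio_fract]
  simp

theorem integral_qpError_sq_le (z : ℝ) :
    ∫ u in Set.Ico (0 : ℝ) 1, qpError z u ^ 2 ≤ 1 / 4 := by
  set f := Int.fract z with hf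
  have h : ∀ u, qpError z u ^ 2 = (1 - 2 * f) * (Set.Iio f).indicator (1 : ℝ → ℝ) u + f ^ 2 := by
    intro u
    rw [qpError_eq, ← hf]
    by_cases hu : u < f
    · simp [hu]; ring
    · simp [hu]
  simp_rw [h]
  rw [integral_add ((integrable_indicator_Iio _).const_mul _) (integrable_const _),
    integral_const_mul, hf, integral_indicator_Iio_fract]
  simp
  nlinarith [sq_nonneg (Int.fract z - 1 / 2)]

theorem integral_unifCube_comp_eval {N : ℕ} (i : Fin N) {f : ℝ → ℝ} (hf : Measurable f) :
    ∫ u, f (u i) ∂unifCube N = ∫ u in Set.Ico (0 : ℝ) 1, f u := by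
  have h := measurePreserving_eval (fun _ : Fin N => volume.restrict (Set.Ico (0 : ℝ) 1)) i
  rw [← h.map_eq, integral_map (measurable_pi_apply i).aemeasurable hf.aestronglyMeasurable]
  rfl

theorem integral_unifCube_mul {N : ℕ} {i j : Fin N} (hij : i ≠ j) {f g : ℝ → ℝ}
    (hf : Measurable f) (hg : Measurable g) :
    ∫ u, f (u i) * g (u j) ∂unifCube N =
      (∫ u in Set.Ico (0 : ℝ) 1, f u) * ∫ u in Set.Ico (0 : ℝ) 1, g u := by
  have h : iIndepFun (fun (k : Fin N) (u : Fin N → ℝ) => u k) (unifCube N) :=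
    iIndepFun_pi (X := fun _ => id) fun _ => aemeasurable_id
  have h2 := (h.indepFun hij).comp hf hg
  rw [← integral_unifCube_comp_eval i hf, ← integral_unifCube_comp_eval j hg]
  exact h2.integral_fun_mul_eq_mul_integral
    (hf.comp (measurable_pi_apply i)).aestronglyMeasurable
    (hg.comp (measurable_pi_apply j)).aestronglyMeasurable

theorem integrable_qpError_mul {N : ℕ} (i j : Fin N) (a b : ℝ) :
    Integrable (fun u => qpError a (u i) * qpError b (u j)) (unifCube N) := by
  refine Integrable.of_bound (C := 1) ?_ (Filter.Eventually.of_forall fun u => ?_)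
  · exact (((measurable_qpError a).comp (measurable_pi_apply i)).mul
      ((measurable_qpError b).comp (measurable_pi_apply j))).aestronglyMeasurable
  · rw [Real.norm_eq_abs, abs_mul]
    exact mul_le_one₀ (abs_qpError_le _ _) (abs_nonneg _) (abs_qpError_le _ _)

theorem integrable_qpError {N : ℕ} (i : Fin N) (a : ℝ) :
    Integrable (fun u => qpError a (u i)) (unifCube N) := by
  refine Integrable.of_bound (C := 1) ?_ (Filter.Eventually.of_forall fun u => ?_)
  · exact ((measurable_qpError a).comp (measurable_pi_apply i)).aestronglyMeasurable
  · exact abs_qpError_le _ _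

/-- The mean square of an affine combination of two quantized values. -/
theorem integral_sub_qp_sq_le {N : ℕ} {i j : Fin N} (hij : i ≠ j) (a b α β : ℝ) :
    ∫ u, (α - β * (((qp a (u i) : ℝ) - (qp b (u j) : ℝ)) / 2)) ^ 2 ∂unifCube N ≤
      (α - β * ((a - b) / 2)) ^ 2 + β ^ 2 / 8 := by
  set γ := α - β * ((a - b) / 2) with hγ
  have h : ∀ u : Fin N → ℝ, (α - β * (((qp a (u i) : ℝ) - (qp b (u j) : ℝ)) / 2)) ^ 2 =
      γ ^ 2 + ((-(γ * β)) * qpError a (u i) + (γ * β * qpError b (u j) +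
        (β ^ 2 / 4 * (qpError a (u i) * qpError a (u i)) +
          (β ^ 2 / 4 * (qpError b (u j) * qpError b (u j)) +
            (-(β ^ 2 / 2)) * (qpError a (u i) * qpError b (u j)))))) := by
    intro u; rw [hγ]; unfold qpError; ring
  have ha := integrable_qpError i a
  have hb := integrable_qpError j b
  have haa := integrable_qpError_mul i i a a
  have hbb := integrable_qpError_mul j j b b
  have hab := integrable_qpError_mul i j a b
  simp_rw [h]
  rw [integral_add (by fun_prop) (by fun_prop), integral_add (by fun_prop) (by fun_prop),
    integral_add (by fun_prop) (by fun_prop), integral_add (by fun_prop) (by fun_prop),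
    integral_add (by fun_prop) (by fun_prop)]
  simp_rw [integral_const_mul]
  have va := integral_qpError_sq_le a
  have vb := integral_qpError_sq_le b
  simp_rw [pow_two (qpError _ _)] at va vb
  rw [← integral_unifCube_comp_eval i (f := fun u => qpError a u * qpError a u)
    ((measurable_qpError a).mul (measurable_qpError a))] at va
  rw [← integral_unifCube_comp_eval j (f := fun u => qpError b u * qpError b u)
    ((measurable_qpError b).mul (measurable_qpError b))] at vb
  rw [integral_unifCube_mul hij (measurable_qpError a) (measurable_qpError b),
    integral_unifCube_comp_eval i (measurable_qpError a),
    integral_unifCube_comp_eval j (measurable_qpError b), integral_qpError, integral_qpError]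
  simp only [integral_const, probReal_univ, smul_eq_mul] at *
  nlinarith [sq_nonneg β, mul_le_mul_of_nonneg_left va (sq_nonneg β),
    mul_le_mul_of_nonneg_left vb (sq_nonneg β)]

theorem transfer_dotProduct {N : ℕ} (i j : Fin N) (c : ℝ) (w y : Fin N → ℝ) :
    transfer i j c w ⬝ᵥ y = w ⬝ᵥ y - c * (y i - y j) := by
  simp [transfer, sub_dotProduct]

theorem dotProduct_transfer {N : ℕ} (i j : Fin N) (c : ℝ) (w y : Fin N → ℝ) :
    w ⬝ᵥ transfer i j c y = w ⬝ᵥ y - c * (w i - w j) := by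
  rw [dotProduct_comm, transfer_dotProduct, dotProduct_comm]

/-- Averaging two coordinates dissipates half of their squared difference. -/
theorem transfer_dotProduct_self {N : ℕ} {i j : Fin N} (hij : i ≠ j) (w : Fin N → ℝ) :
    transfer i j ((w i - w j) / 2) w ⬝ᵥ transfer i j ((w i - w j) / 2) w =
      w ⬝ᵥ w - (w i - w j) ^ 2 / 2 := by
  rw [transfer_dotProduct, dotProduct_transfer]
  simp [transfer, hij, hij.symm]
  ring

/-- The sum of squared deviations from the mean. -/
noncomputable def sqDev {N : ℕ} (w : Fin N → ℝ) : ℝ := w ⬝ᵥ w - (N : ℝ)⁻¹ * (w ⬝ᵥ 1) ^ 2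

theorem sqDev_transfer {N : ℕ} {i j : Fin N} (hij : i ≠ j) (w : Fin N → ℝ) :
    sqDev (transfer i j ((w i - w j) / 2) w) = sqDev w - (w i - w j) ^ 2 / 2 := by
  unfold sqDev
  rw [transfer_dotProduct_self hij, transfer_dotProduct]
  simp; ring

theorem sum_sub_sq {N : ℕ} (hN : N ≠ 0) (w : Fin N → ℝ) (c : ℝ) :
    ∑ i, (w i - c) ^ 2 = sqDev w + N * ((N : ℝ)⁻¹ * (w ⬝ᵥ 1) - c) ^ 2 := by
  have hN' : (N : ℝ) ≠ 0 := by exact_mod_cast hN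
  have : ∑ i, (w i - c) ^ 2 = w ⬝ᵥ w - 2 * c * (w ⬝ᵥ 1) + N * c ^ 2 := by
    simp only [dotProduct, Finset.mul_sum, sub_sq, Finset.sum_add_distrib, Finset.sum_sub_distrib]
    simp [pow_two, mul_comm, mul_left_comm]
  rw [this, sqDev]
  field_simp
  ring

theorem sqDev_le_sum {N : ℕ} (hN : N ≠ 0) (w : Fin N → ℝ) (c : ℝ) :
    sqDev w ≤ ∑ i, (w i - c) ^ 2 := by
  rw [sum_sub_sq hN]
  have : (0 : ℝ) ≤ N * ((N : ℝ)⁻¹ * (w ⬝ᵥ 1) - c) ^ 2 := by positivity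
  linarith

/-- Pairing with a vector of zero sum is controlled by the deviation from the mean. -/
theorem dotProduct_sq_le {N : ℕ} (hN : N ≠ 0) (w u : Fin N → ℝ) (hu : ∑ i, u i = 0) :
    (w ⬝ᵥ u) ^ 2 ≤ (u ⬝ᵥ u) * sqDev w := by
  set c := (N : ℝ)⁻¹ * (w ⬝ᵥ 1) with hc
  have h := sum_sub_sq hN w c
  simp only [hc, sub_self, ne_eq, OfNat.ofNat_ne_zero, not_false_eq_true, zero_pow, mul_zero,
    add_zero] at h
  have h1 : w ⬝ᵥ u = ∑ i, u i * (w i - c) := by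
    simp_rw [mul_sub, Finset.sum_sub_distrib, ← Finset.sum_mul, hu]
    simp [dotProduct, mul_comm]
  rw [← h, h1]
  refine (Finset.sum_mul_sq_le_sq_mul_sq _ _ _).trans (le_of_eq ?_)
  simp [dotProduct, pow_two, hc]

/-- A Poincaré inequality on a connected graph with positive edge weights. -/
theorem exists_sqDev_le {N : ℕ} (hN : N ≠ 0) {G : SimpleGraph (Fin N)} (hG : G.Connected)
    (p : Sym2 (Fin N) → ℝ) (hp0 : ∀ e, 0 ≤ p e) (hp : ∀ e ∈ G.edgeSet, 0 < p e) :
    ∃ C : ℝ, 1 ≤ C ∧ ∀ w : Fin N → ℝ,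
      sqDev w ≤ C * ∑ e, p e * (w e.out.1 - w e.out.2) ^ 2 := by
  have hQ : ∀ w : Fin N → ℝ, 0 ≤ ∑ e, p e * (w e.out.1 - w e.out.2) ^ 2 := fun w =>
    Finset.sum_nonneg fun e _ => mul_nonneg (hp0 e) (sq_nonneg _)
  have hadj : ∀ i j, G.Adj i j → ∀ w : Fin N → ℝ, (w i - w j) ^ 2 ≤
      (p s(i, j))⁻¹ * ∑ e, p e * (w e.out.1 - w e.out.2) ^ 2 := by
    intro i j hij w
    have hpe := hp s(i, j) hij
    rw [inv_mul_eq_div, le_div_iff₀ hpe]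
    have hout : (w i - w j) ^ 2 = (w s(i, j).out.1 - w s(i, j).out.2) ^ 2 := by
      have h : s(s(i, j).out.1, s(i, j).out.2) = s(i, j) := Quot.out_eq s(i, j)
      rcases Sym2.eq_iff.1 h with ⟨h1, h2⟩ | ⟨h1, h2⟩
      · rw [h1, h2]
      · rw [h1, h2]; ring
    rw [hout, mul_comm]
    exact Finset.single_le_sum (f := fun e => p e * (w e.out.1 - w e.out.2) ^ 2)
      (fun e _ => mul_nonneg (hp0 e) (sq_nonneg _)) (Finset.mem_univ _)
  have hreach : ∀ i j, ∃ C : ℝ, 0 ≤ C ∧ ∀ w : Fin N → ℝ, (w i - w j) ^ 2 ≤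
      C * ∑ e, p e * (w e.out.1 - w e.out.2) ^ 2 := by
    intro i j
    obtain ⟨walk⟩ := hG.preconnected i j
    induction walk with
    | nil => exact ⟨0, le_rfl, fun w => by simp⟩
    | @cons a b c hab _ ih =>
      obtain ⟨C, hC, h⟩ := ih
      refine ⟨2 * (p s(a, b))⁻¹ + 2 * C, ?_, fun w => ?_⟩
      · have := (inv_pos.2 (hp s(a, b) hab)).le
        positivity
      · have h1 := hadj a b hab w
        have h2 := h w
        nlinarith [sq_nonneg (w a - w b - (w b - w c))]
  obtain ⟨o⟩ := hG.nonempty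
  choose C hC h using fun i => hreach i o
  refine ⟨1 + ∑ i, C i, le_add_of_nonneg_right (Finset.sum_nonneg fun i _ => hC i), fun w => ?_⟩
  refine (sqDev_le_sum hN w (w o)).trans ?_
  refine (Finset.sum_le_sum fun i _ => h i w).trans ?_
  rw [← Finset.sum_mul]
  nlinarith [hQ w]

theorem measurable_gossipStep {N : ℕ} (i j : Fin N) :
    Measurable fun p : (Fin N → ℝ) × (Fin N → ℝ) => gossipStep i j p.1 p.2 := by
  have hq : ∀ k : Fin N, Measurable fun p : (Fin N → ℝ) × (Fin N → ℝ) =>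
      (qp (p.1 k) (p.2 k) : ℝ) := fun k =>
    measurable_qp.comp (f := fun p : (Fin N → ℝ) × (Fin N → ℝ) => (p.1 k, p.2 k))
      (by fun_prop)
  have h := ((hq i).sub (hq j)).div_const 2
  unfold gossipStep transfer
  exact measurable_fst.sub (h.smul_const _)

/-- A map that agrees with the gossip step along a randomly selected edge is measurable. -/
theorem measurable_of_eq_gossipStep {N : ℕ} {Ω : Type*} [MeasurableSpace Ω]
    {s : Ω → Sym2 (Fin N)} {x x' u : Ω → Fin N → ℝ}
    (hs : ∀ e, MeasurableSet {ω | s ω = e}) (hx : Measurable x) (hu : Measurable u)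
    (h : ∀ ω, x' ω = gossipStep (s ω).out.1 (s ω).out.2 (x ω) (u ω)) : Measurable x' := by
  intro B hB
  have hpre : x' ⁻¹' B = ⋃ e, {ω | s ω = e} ∩
      (fun ω => gossipStep e.out.1 e.out.2 (x ω) (u ω)) ⁻¹' B := by
    ext ω
    simp [h]
  rw [hpre]
  exact MeasurableSet.iUnion fun e =>
    (hs e).inter (((measurable_gossipStep _ _).comp (hx.prodMk hu)) hB)

theorem eq_gossipStep {N : ℕ} {G : SimpleGraph (Fin N)} {e : Sym2 (Fin N)} (he : e ∈ G.edgeSet)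
    {x x' u : Fin N → ℝ}
    (h : ∀ i j, G.Adj i j → e = s(i, j) →
      x' i = x i - (1/2) * (qp (x i) (u i) : ℝ) + (1/2) * (qp (x j) (u j) : ℝ) ∧
      ∀ k, k ≠ i → k ≠ j → x' k = x k) :
    x' = gossipStep e.out.1 e.out.2 x u := by
  have hout : s(e.out.1, e.out.2) = e := Quot.out_eq e
  generalize e.out.1 = i at *
  generalize e.out.2 = j at *
  subst hout
  have hij : G.Adj i j := he
  have h1 := h i j hij rfl
  have h2 := h j i hij.symm Sym2.eq_swap
  ext k
  by_cases hki : k = i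
  · subst hki
    simp [gossipStep, transfer, h1.1, hij.ne]; ring
  by_cases hkj : k = j
  · subst hkj
    simp [gossipStep, transfer, h2.1, hij.ne.symm]; ring
  · simp [gossipStep, transfer, h1.2 k hki hkj, hki, hkj]

/-- Events determined by the value of `s` together with a measurable condition on `u`. -/
def selectionEvents {N : ℕ} {Ω : Type*} (s : Ω → Sym2 (Fin N)) (u : Ω → Fin N → ℝ) :
    Set (Set Ω) :=
  {S | ∃ e B, MeasurableSet B ∧ S = {ω | s ω = e} ∩ {ω | u ω ∈ B}}

theorem isPiSystem_selectionEvents {N : ℕ} {Ω : Type*} (s : Ω → Sym2 (Fin N))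
    (u : Ω → Fin N → ℝ) : IsPiSystem (selectionEvents s u) := by
  rintro _ ⟨e, B, hB, rfl⟩ _ ⟨e', B', hB', rfl⟩ ⟨ω, ⟨h1, -⟩, ⟨h2, -⟩⟩
  obtain rfl : e = e' := h1.symm.trans h2
  refine ⟨e, B ∩ B', hB.inter hB', ?_⟩
  ext ω
  simp only [Set.mem_inter_iff, Set.mem_ofPred_eq]
  tauto

theorem measurableSet_selection {N : ℕ} {Ω : Type*} {s : Ω → Sym2 (Fin N)}
    {u : Ω → Fin N → ℝ} (e : Sym2 (Fin N)) :
    MeasurableSet[MeasurableSpace.generateFrom (selectionEvents s u)] {ω | s ω = e} :=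
  MeasurableSpace.measurableSet_generateFrom ⟨e, Set.univ, MeasurableSet.univ, by simp⟩

theorem measurable_selection {N : ℕ} {Ω : Type*} {s : Ω → Sym2 (Fin N)}
    {u : Ω → Fin N → ℝ} :
    Measurable[MeasurableSpace.generateFrom (selectionEvents s u)] u := by
  intro B hB
  have hpre : u ⁻¹' B = ⋃ e, {ω | s ω = e} ∩ {ω | u ω ∈ B} := by
    ext ω
    simp
  rw [hpre]
  exact MeasurableSet.iUnion fun e =>
    MeasurableSpace.measurableSet_generateFrom ⟨e, B, hB, rfl⟩

/-- The state at time `t` is a function of the selections before time `t`. -/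
theorem measurable_state {N : ℕ} {Ω : Type*} {σ : ℕ → Ω → Sym2 (Fin N)} {U : ℕ → Ω → Fin N → ℝ}
    {x : ℕ → Ω → Fin N → ℝ} {x0 : Fin N → ℝ} (h0 : ∀ ω, x 0 ω = x0)
    (hstep : ∀ t ω, x (t + 1) ω =
      gossipStep (σ t ω).out.1 (σ t ω).out.2 (x t ω) (U t ω)) (t : ℕ) :
    Measurable[⨆ r ∈ Set.Iio t, MeasurableSpace.generateFrom (selectionEvents (σ r) (U r))]
      (x t) := by
  induction t with
  | zero =>
    rw [show x 0 = fun _ => x0 from funext h0]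
    exact measurable_const
  | succ t ih =>
    have hle : MeasurableSpace.generateFrom (selectionEvents (σ t) (U t)) ≤
        ⨆ r ∈ Set.Iio (t + 1), MeasurableSpace.generateFrom (selectionEvents (σ r) (U r)) :=
      le_biSup (fun r => MeasurableSpace.generateFrom (selectionEvents (σ r) (U r)))
        (Set.mem_Iio.2 t.lt_succ_self)
    have hmono : (⨆ r ∈ Set.Iio t,
          MeasurableSpace.generateFrom (selectionEvents (σ r) (U r))) ≤
        ⨆ r ∈ Set.Iio (t + 1), MeasurableSpace.generateFrom (selectionEvents (σ r) (U r)) :=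
      biSup_mono fun r hr => (Set.mem_Iio.1 hr).trans t.lt_succ_self
    exact @measurable_of_eq_gossipStep N Ω (⨆ r ∈ Set.Iio (t + 1),
      MeasurableSpace.generateFrom (selectionEvents (σ r) (U r))) (σ t) (x t) (x (t + 1)) (U t)
      (fun e => hle _ (measurableSet_selection e)) (ih.mono hmono le_rfl)
      (measurable_selection.mono hle le_rfl) (hstep t)

section IndependentSelections

variable {N : ℕ} {Ω : Type*} [MeasurableSpace Ω] {P : Measure Ω}
  {σ : ℕ → Ω → Sym2 (Fin N)} {U : ℕ → Ω → Fin N → ℝ}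

theorem generateFrom_selectionEvents_le
    (hmeasσ : ∀ (t : ℕ) (e : Sym2 (Fin N)), MeasurableSet {ω | σ t ω = e})
    (hmeasU : ∀ t : ℕ, Measurable (U t)) (t : ℕ) :
    MeasurableSpace.generateFrom (selectionEvents (σ t) (U t)) ≤ ‹MeasurableSpace Ω› := by
  refine MeasurableSpace.generateFrom_le ?_
  rintro _ ⟨e, B, hB, rfl⟩
  exact (hmeasσ t e).inter (hmeasU t hB)

theorem iIndep_selectionEvents [IsProbabilityMeasure P]
    (hmeasσ : ∀ (t : ℕ) (e : Sym2 (Fin N)), MeasurableSet {ω | σ t ω = e})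
    (hmeasU : ∀ t : ℕ, Measurable (U t))
    (hiid : ∀ (s : Finset ℕ) (f : ℕ → Sym2 (Fin N)) (B : ℕ → Set (Fin N → ℝ)),
      (∀ t, MeasurableSet (B t)) →
      P (⋂ t ∈ s, ({ω | σ t ω = f t} ∩ {ω | U t ω ∈ B t})) =
        ∏ t ∈ s, (P {ω | σ 0 ω = f t} * unifCube N (B t))) :
    iIndep (fun t => MeasurableSpace.generateFrom (selectionEvents (σ t) (U t))) P := by
  refine iIndepSets.iIndep (generateFrom_selectionEvents_le hmeasσ hmeasU)
    (fun t => selectionEvents (σ t) (U t)) (fun t => isPiSystem_selectionEvents _ _)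
    (fun _ => rfl) ?_
  rw [iIndepSets_iff]
  intro s f hf
  have : ∀ t, ∃ e B, MeasurableSet B ∧
      (t ∈ s → f t = {ω | σ t ω = e} ∩ {ω | U t ω ∈ B}) := by
    intro t
    by_cases ht : t ∈ s
    · obtain ⟨e, B, hB, h⟩ := hf t ht
      exact ⟨e, B, hB, fun _ => h⟩
    · obtain ⟨ω⟩ := nonempty_of_isProbabilityMeasure P
      exact ⟨σ 0 ω, ∅, MeasurableSet.empty, fun h => absurd h ht⟩
  choose e B hB h using this
  have hsingle : ∀ t ∈ s, P (f t) = P {ω | σ 0 ω = e t} * unifCube N (B t) := by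
    intro t ht
    have := hiid {t} e B hB
    simpa [h t ht] using this
  rw [Finset.prod_congr rfl hsingle, ← hiid s e B hB]
  exact congrArg P (Set.iInter₂_congr h)

/-- On the event that edge `e` is selected, the state and the dither are independent. -/
theorem map_restrict_selection [IsProbabilityMeasure P]
    (hmeasσ : ∀ (t : ℕ) (e : Sym2 (Fin N)), MeasurableSet {ω | σ t ω = e})
    (hmeasU : ∀ t : ℕ, Measurable (U t))
    (hiid : ∀ (s : Finset ℕ) (f : ℕ → Sym2 (Fin N)) (B : ℕ → Set (Fin N → ℝ)),
      (∀ t, MeasurableSet (B t)) →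
      P (⋂ t ∈ s, ({ω | σ t ω = f t} ∩ {ω | U t ω ∈ B t})) =
        ∏ t ∈ s, (P {ω | σ 0 ω = f t} * unifCube N (B t)))
    {x : ℕ → Ω → Fin N → ℝ} {x0 : Fin N → ℝ} (h0 : ∀ ω, x 0 ω = x0)
    (hstep : ∀ t ω, x (t + 1) ω =
      gossipStep (σ t ω).out.1 (σ t ω).out.2 (x t ω) (U t ω)) (t : ℕ) (e : Sym2 (Fin N)) :
    (P.restrict {ω | σ t ω = e}).map (fun ω => (x t ω, U t ω)) =
      P {ω | σ 0 ω = e} • (P.map (x t)).prod (unifCube N) := by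
  have hle := generateFrom_selectionEvents_le hmeasσ hmeasU
  have hx := measurable_state h0 hstep t
  have hx' : Measurable (x t) := hx.mono (iSup₂_le fun r _ => hle r) le_rfl
  have hind := indep_iSup_of_disjoint hle (iIndep_selectionEvents hmeasσ hmeasU hiid)
    (S := Set.Iio t) (T := {t}) (by simp)
  rw [Indep_iff] at hind
  have := Measure.smul_finite (P.map (x t)) (measure_ne_top P {ω | σ 0 ω = e})
  rw [← Measure.prod_smul_left]
  symm
  refine Measure.prod_eq fun A B hA hB => ?_
  rw [Measure.map_apply (hx'.prodMk (hmeasU t)) (hA.prod hB),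
    Measure.restrict_apply ((hx'.prodMk (hmeasU t)) (hA.prod hB)), Measure.smul_apply,
    Measure.map_apply hx' hA]
  have hsel := hiid {t} (fun _ => e) (fun _ => B) (fun _ => hB)
  simp only [Finset.mem_singleton, Set.iInter_iInter_eq_left, Finset.prod_singleton] at hsel
  have hset : (fun ω => (x t ω, U t ω)) ⁻¹' A ×ˢ B ∩ {ω | σ t ω = e} =
      x t ⁻¹' A ∩ ({ω | σ t ω = e} ∩ {ω | U t ω ∈ B}) := by
    ext ω
    simp only [Set.mem_inter_iff, Set.mem_preimage, Set.mem_prod, Set.mem_ofPred_eq]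
    tauto
  have hmeas := le_biSup
    (fun r => MeasurableSpace.generateFrom (selectionEvents (σ r) (U r))) (Set.mem_singleton t) _
    (MeasurableSpace.measurableSet_generateFrom ⟨e, B, hB, rfl⟩)
  rw [hset, hind _ _ (hx hA) hmeas, hsel, smul_eq_mul]
  ring

end IndependentSelections

/-- One gossip step along `(i, j)` acts on second moments by averaging the test vector,
up to the variance contributed by the quantizer. -/
theorem setIntegral_gossipStep_le {N : ℕ} {Ω : Type*} [MeasurableSpace Ω] {P : Measure Ω}
    [IsProbabilityMeasure P] {x u : Ω → Fin N → ℝ} (hx : Measurable x) (hu : Measurable u)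
    {S : Set Ω} {p : ENNReal} (hp0 : p ≠ 0) (hp : p ≠ ⊤)
    (hlaw : (P.restrict S).map (fun ω => (x ω, u ω)) = p • (P.map x).prod (unifCube N))
    {i j : Fin N} (hij : i ≠ j) (w : Fin N → ℝ) (c : ℝ)
    (hint : Integrable
      (fun ω => (transfer i j ((w i - w j) / 2) w ⬝ᵥ (x ω - fun _ => c)) ^ 2) P)
    (hint_step : IntegrableOn (fun ω => (w ⬝ᵥ (gossipStep i j (x ω) (u ω) - fun _ => c)) ^ 2) S P) :
    ∫ ω in S, (w ⬝ᵥ (gossipStep i j (x ω) (u ω) - fun _ => c)) ^ 2 ∂P ≤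
      p.toReal * (∫ ω, (transfer i j ((w i - w j) / 2) w ⬝ᵥ (x ω - fun _ => c)) ^ 2 ∂P +
        (w i - w j) ^ 2 / 8) := by
  have hprob : IsProbabilityMeasure (P.map x) := Measure.isProbabilityMeasure_map hx.aemeasurable
  have hdot : ∀ v : Fin N → ℝ, Measurable fun y : Fin N → ℝ => (v ⬝ᵥ (y - fun _ => c)) ^ 2 := by
    intro v
    simp only [dotProduct, Pi.sub_apply]
    fun_prop
  set g : (Fin N → ℝ) × (Fin N → ℝ) → ℝ :=
    fun q => (w ⬝ᵥ (gossipStep i j q.1 q.2 - fun _ => c)) ^ 2 with hg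
  have hgm : Measurable g := (hdot w).comp (measurable_gossipStep i j)
  have hxu : Measurable fun ω => (x ω, u ω) := hx.prodMk hu
  have hgi : Integrable g ((P.map x).prod (unifCube N)) := by
    rw [← integrable_smul_measure hp0 hp, ← hlaw,
      integrable_map_measure hgm.aestronglyMeasurable hxu.aemeasurable]
    exact hint_step
  have hmap : ∫ ω in S, g (x ω, u ω) ∂P = ∫ q, g q ∂(p • (P.map x).prod (unifCube N)) := by
    rw [← hlaw, integral_map hxu.aemeasurable hgm.aestronglyMeasurable]
  refine hmap.trans_le ?_
  rw [integral_smul_measure, integral_prod _ hgi, smul_eq_mul]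
  refine mul_le_mul_of_nonneg_left ?_ ENNReal.toReal_nonneg
  have hinner : ∀ y, ∫ v, g (y, v) ∂unifCube N ≤
      (transfer i j ((w i - w j) / 2) w ⬝ᵥ (y - fun _ => c)) ^ 2 + (w i - w j) ^ 2 / 8 := by
    intro y
    have h := integral_sub_qp_sq_le hij (y i) (y j) (w ⬝ᵥ (y - fun _ => c)) (w i - w j)
    have hα : transfer i j ((w i - w j) / 2) w ⬝ᵥ (y - fun _ => c) =
        w ⬝ᵥ (y - fun _ => c) - (w i - w j) * ((y i - y j) / 2) := by
      rw [transfer_dotProduct]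
      simp only [Pi.sub_apply]
      ring
    have hgy : ∀ v, g (y, v) = (w ⬝ᵥ (y - fun _ => c) -
        (w i - w j) * (((qp (y i) (v i) : ℝ) - (qp (y j) (v j) : ℝ)) / 2)) ^ 2 := by
      intro v
      simp only [hg, gossipStep, dotProduct_sub, dotProduct_transfer]
      ring
    simp_rw [hgy, hα]
    exact h
  have hint2 : Integrable
      (fun y => (transfer i j ((w i - w j) / 2) w ⬝ᵥ (y - fun _ => c)) ^ 2) (P.map x) :=
    (integrable_map_measure (hdot _).aestronglyMeasurable hx.aemeasurable).2 hint
  refine (integral_mono hgi.integral_prod_left (hint2.add (integrable_const _)) hinner).trans ?_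
  rw [integral_add' hint2 (integrable_const _),
    integral_map hx.aemeasurable (hdot _).aestronglyMeasurable]
  simp

theorem integrable_dotProduct_sq {N : ℕ} {Ω : Type*} [MeasurableSpace Ω] {P : Measure Ω}
    {x : Ω → Fin N → ℝ} (hx : Measurable x) {c : ℝ}
    (hint : Integrable (fun ω => ∑ i, (x ω i - c) ^ 2) P) (w : Fin N → ℝ) :
    Integrable (fun ω => (w ⬝ᵥ (x ω - fun _ => c)) ^ 2) P := by
  refine (hint.const_mul (∑ i, w i ^ 2)).mono' ?_ (Filter.Eventually.of_forall fun ω => ?_)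
  · refine Measurable.aestronglyMeasurable ?_
    simp only [dotProduct, Pi.sub_apply]
    fun_prop
  · rw [Real.norm_of_nonneg (sq_nonneg _)]
    exact Finset.sum_mul_sq_le_sq_mul_sq _ _ _

theorem iUnion_fiber {α β : Type*} (f : α → β) : ⋃ b, {a | f a = b} = Set.univ := by
  ext a
  simp

/-- A sequence of quadratic functionals obeying the gossip recursion is bounded by a quarter of
the squared norm, up to a geometrically vanishing term. -/
theorem le_quarter_add_of_gossip_recursion {N : ℕ} {G : SimpleGraph (Fin N)}
    (p : Sym2 (Fin N) → ℝ) (hp0 : ∀ e, 0 ≤ p e) (hp1 : ∑ e, p e = 1)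
    (hpG : ∀ e ∉ G.edgeSet, p e = 0) {C : ℝ} (hC1 : 1 ≤ C)
    (hC : ∀ w : Fin N → ℝ, sqDev w ≤ C * ∑ e, p e * (w e.out.1 - w e.out.2) ^ 2)
    {F : ℕ → (Fin N → ℝ) → ℝ} {K : ℝ} (hK : 0 ≤ K) (hF0 : ∀ w, F 0 w ≤ K * sqDev w)
    (hF : ∀ t w, F (t + 1) w ≤ ∑ e, p e *
      (F t (transfer e.out.1 e.out.2 ((w e.out.1 - w e.out.2) / 2) w) +
        (w e.out.1 - w e.out.2) ^ 2 / 8)) (t : ℕ) (w : Fin N → ℝ) :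
    F t w ≤ w ⬝ᵥ w / 4 + K * (1 - 1 / (2 * C)) ^ t * sqDev w := by
  have hCpos : 0 < C := by linarith
  have hρ : 0 ≤ 1 - 1 / (2 * C) := by
    rw [sub_nonneg, div_le_one (by positivity)]
    linarith
  induction t generalizing w with
  | zero =>
    have h : 0 ≤ w ⬝ᵥ w := Finset.sum_nonneg fun i _ => mul_self_nonneg (w i)
    have := hF0 w
    rw [pow_zero, mul_one]
    linarith
  | succ t ih =>
    have hKρ : 0 ≤ K * (1 - 1 / (2 * C)) ^ t := by positivity
    refine (hF t w).trans ?_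
    have hterm : ∀ e ∈ Finset.univ, p e *
        (F t (transfer e.out.1 e.out.2 ((w e.out.1 - w e.out.2) / 2) w) +
          (w e.out.1 - w e.out.2) ^ 2 / 8) ≤
        p e * (w ⬝ᵥ w / 4 + K * (1 - 1 / (2 * C)) ^ t * sqDev w) -
          K * (1 - 1 / (2 * C)) ^ t / 2 * (p e * (w e.out.1 - w e.out.2) ^ 2) := by
      intro e _
      by_cases he : e ∈ G.edgeSet
      · have hne : e.out.1 ≠ e.out.2 := by
          have hout : s(e.out.1, e.out.2) = e := Quot.out_eq e
          rw [← hout, SimpleGraph.mem_edgeSet] at he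
          exact he.ne
        have h := ih (transfer e.out.1 e.out.2 ((w e.out.1 - w e.out.2) / 2) w)
        rw [transfer_dotProduct_self hne, sqDev_transfer hne] at h
        have := mul_le_mul_of_nonneg_left h (hp0 e)
        linarith
      · simp [hpG e he]
    refine (Finset.sum_le_sum hterm).trans ?_
    rw [Finset.sum_sub_distrib, ← Finset.sum_mul, ← Finset.mul_sum, hp1, one_mul, pow_succ]
    have hQ : sqDev w / C ≤ ∑ e, p e * (w e.out.1 - w e.out.2) ^ 2 := by
      rw [div_le_iff₀ hCpos, mul_comm]
      exact hC w
    have := mul_le_mul_of_nonneg_left hQ (div_nonneg hKρ zero_le_two)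
    have hid : K * ((1 - 1 / (2 * C)) ^ t * (1 - 1 / (2 * C))) * sqDev w =
        K * (1 - 1 / (2 * C)) ^ t * sqDev w -
          K * (1 - 1 / (2 * C)) ^ t / 2 * (sqDev w / C) := by
      field_simp
    rw [hid]
    linarith

/-- Compensating gossip algorithm with probabilistic quantizer: the asymptotic
root-mean-square distance from the initial average,
`limsup_t √((1/N)·E[∑ᵢ (xᵢ(t) − x_ave(0))²])`, is at most `1/2`. -/
theorem stmt_8 {N : ℕ} (hN : 2 ≤ N) (G : SimpleGraph (Fin N)) (hG : G.Connected)
    {Ω : Type*} [MeasurableSpace Ω] (P : Measure Ω) [IsProbabilityMeasure P]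
    (σ : ℕ → Ω → Sym2 (Fin N)) (U : ℕ → Ω → Fin N → ℝ)
    (hrange : ∀ t ω, σ t ω ∈ G.edgeSet)
    (hmeasσ : ∀ (t : ℕ) (e : Sym2 (Fin N)), MeasurableSet {ω | σ t ω = e})
    (hmeasU : ∀ t : ℕ, Measurable (U t))
    (hiid : ∀ (s : Finset ℕ) (f : ℕ → Sym2 (Fin N)) (B : ℕ → Set (Fin N → ℝ)),
      (∀ t, MeasurableSet (B t)) →
      P (⋂ t ∈ s, ({ω | σ t ω = f t} ∩ {ω | U t ω ∈ B t})) =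
        ∏ t ∈ s, (P {ω | σ 0 ω = f t} * unifCube N (B t)))
    (hpos : ∀ e ∈ G.edgeSet, 0 < P {ω | σ 0 ω = e})
    (x0 : Fin N → ℝ) (x : ℕ → Ω → Fin N → ℝ)
    (h0 : ∀ ω, x 0 ω = x0)
    (hupd : ∀ (t : ℕ) (ω : Ω) (i j : Fin N), G.Adj i j → σ t ω = s(i, j) →
      x (t+1) ω i = x t ω i - (1/2) * ((qp (x t ω i) (U t ω i) : ℤ) : ℝ)
        + (1/2) * ((qp (x t ω j) (U t ω j) : ℤ) : ℝ) ∧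
      ∀ h : Fin N, h ≠ i → h ≠ j → x (t+1) ω h = x t ω h)
    (xave : ℝ) (hxave : xave = (N : ℝ)⁻¹ * ∑ i, x0 i)
    (hint : ∀ t, Integrable (fun ω => ∑ i, (x t ω i - xave)^2) P) :
    Filter.limsup (fun t =>
        Real.sqrt ((N : ℝ)⁻¹ * ∫ ω, ∑ i, (x t ω i - xave)^2 ∂P)) Filter.atTop
      ≤ 1/2 := by
  have hN0 : N ≠ 0 := by omega
  have hNpos : (0 : ℝ) < N := by exact_mod_cast Nat.pos_of_ne_zero hN0
  have hstep : ∀ t ω, x (t + 1) ω =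
      gossipStep (σ t ω).out.1 (σ t ω).out.2 (x t ω) (U t ω) := fun t ω =>
    eq_gossipStep (hrange t ω) fun i j hij he => hupd t ω i j hij he
  have hx : ∀ t, Measurable (x t) := fun t => (measurable_state h0 hstep t).mono
    (iSup₂_le fun r _ => generateFrom_selectionEvents_le hmeasσ hmeasU r) le_rfl
  have hFint := fun t => integrable_dotProduct_sq (hx t) (hint t)
  set F : ℕ → (Fin N → ℝ) → ℝ :=
    fun t w => ∫ ω, (w ⬝ᵥ (x t ω - fun _ => xave)) ^ 2 ∂P with hFdef
  set p : Sym2 (Fin N) → ℝ := fun e => (P {ω | σ 0 ω = e}).toReal with hp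
  have hp0 : ∀ e, 0 ≤ p e := fun e => ENNReal.toReal_nonneg
  have hpG : ∀ e ∉ G.edgeSet, p e = 0 := by
    intro e he
    have : {ω | σ 0 ω = e} = ∅ :=
      Set.eq_empty_of_forall_notMem fun ω hω => he (hω ▸ hrange 0 ω)
    simp [hp, this]
  have hp1 : ∑ e, p e = 1 := by
    have h := integral_iUnion_fintype (μ := P) (f := fun _ => (1 : ℝ)) (hmeasσ 0)
      (pairwise_disjoint_fiber (σ 0)) fun e => (integrable_const _).integrableOn
    rw [iUnion_fiber] at h
    simpa [Measure.real] using h.symm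
  obtain ⟨C, hC1, hC⟩ := exists_sqDev_le hN0 hG p hp0
    fun e he => ENNReal.toReal_pos (hpos e he).ne' (measure_ne_top _ _)
  have hrec : ∀ t w, F (t + 1) w ≤ ∑ e, p e *
      (F t (transfer e.out.1 e.out.2 ((w e.out.1 - w e.out.2) / 2) w) +
        (w e.out.1 - w e.out.2) ^ 2 / 8) := by
    intro t w
    have h := integral_iUnion_fintype (hmeasσ t) (pairwise_disjoint_fiber (σ t))
      fun e => (hFint (t + 1) w).integrableOn
    rw [iUnion_fiber, Measure.restrict_univ] at h
    refine h.trans_le (Finset.sum_le_sum fun e _ => ?_)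
    by_cases he : e ∈ G.edgeSet
    · have hne : e.out.1 ≠ e.out.2 := by
        have hout : s(e.out.1, e.out.2) = e := Quot.out_eq e
        have he' := he
        rw [← hout, SimpleGraph.mem_edgeSet] at he'
        exact he'.ne
      have hcongr : Set.EqOn (fun ω => (w ⬝ᵥ (x (t + 1) ω - fun _ => xave)) ^ 2)
          (fun ω => (w ⬝ᵥ (gossipStep e.out.1 e.out.2 (x t ω) (U t ω) - fun _ => xave)) ^ 2)
          {ω | σ t ω = e} := by
        intro ω hω
        have hω' : σ t ω = e := hω
        simp only [hstep, hω']
      rw [setIntegral_congr_fun (hmeasσ t e) hcongr]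
      exact setIntegral_gossipStep_le (hx t) (hmeasU t) (hpos e he).ne' (measure_ne_top _ _)
        (map_restrict_selection hmeasσ hmeasU hiid h0 hstep t e) hne w xave (hFint t _)
        ((hFint (t + 1) w).integrableOn.congr_fun hcongr (hmeasσ t e))
    · have : {ω | σ t ω = e} = ∅ :=
        Set.eq_empty_of_forall_notMem fun ω hω => he (hω ▸ hrange t ω)
      simp [this, hpG e he]
  set u : Fin N → ℝ := x0 - fun _ => xave with hu
  have hu0 : ∑ i, u i = 0 := by
    simp [hu, hxave, hN0]
  have hK : 0 ≤ u ⬝ᵥ u := Finset.sum_nonneg fun i _ => mul_self_nonneg (u i)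
  have hF0 : ∀ w, F 0 w ≤ (u ⬝ᵥ u) * sqDev w := by
    intro w
    simp only [hFdef, h0, integral_const, probReal_univ, one_smul]
    exact dotProduct_sq_le hN0 w u hu0
  have hbound := le_quarter_add_of_gossip_recursion p hp0 hp1 hpG hC1 hC hK hF0 hrec
  set ρ := 1 - 1 / (2 * C) with hρdef
  set D := (N : ℝ)⁻¹ * (u ⬝ᵥ u) * ∑ i : Fin N, sqDev (Pi.single i (1 : ℝ)) with hD
  have hV : ∀ t, (N : ℝ)⁻¹ * ∫ ω, ∑ i, (x t ω i - xave) ^ 2 ∂P ≤ 1 / 4 + D * ρ ^ t := by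
    intro t
    have hsum : ∫ ω, ∑ i, (x t ω i - xave) ^ 2 ∂P = ∑ i, F t (Pi.single i 1) := by
      simp only [hFdef]
      rw [← integral_finsetSum _ fun i _ => hFint t (Pi.single i 1)]
      simp
    rw [hsum]
    have h := Finset.sum_le_sum fun (i : Fin N) (_ : i ∈ Finset.univ) =>
      hbound t (Pi.single i (1 : ℝ))
    rw [Finset.sum_add_distrib, ← Finset.mul_sum] at h
    refine (mul_le_mul_of_nonneg_left h (inv_nonneg.2 hNpos.le)).trans (le_of_eq ?_)
    simp only [single_dotProduct, Pi.single_eq_same, one_mul, Finset.sum_const, Finset.card_univ,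
      Fintype.card_fin, nsmul_eq_mul, hD]
    field_simp
  have hρ0 : 0 ≤ ρ := by
    rw [hρdef, sub_nonneg, div_le_one (by linarith)]
    linarith
  have hρ1 : ρ < 1 := by
    have : 0 < 1 / (2 * C) := by positivity
    linarith
  have hlim : Filter.Tendsto (fun t : ℕ => Real.sqrt (1 / 4 + D * ρ ^ t)) Filter.atTop
      (nhds (1 / 2)) := by
    have h := ((tendsto_pow_atTop_nhds_zero_of_lt_one hρ0 hρ1).const_mul D).const_add (1 / 4)
    have hval : Real.sqrt (1 / 4 + D * 0) = 1 / 2 := by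
      rw [mul_zero, add_zero, show (1 : ℝ) / 4 = (1 / 2) ^ 2 by norm_num,
        Real.sqrt_sq (by norm_num)]
    exact hval ▸ h.sqrt
  rw [← hlim.limsup_eq]
  refine Filter.limsup_le_limsup (Filter.Eventually.of_forall fun t => Real.sqrt_le_sqrt (hV t))
    ?_ hlim.isBoundedUnder_le
  exact Filter.isCoboundedUnder_le_of_le Filter.atTop fun t => Real.sqrt_nonneg _
end

section
/- Define g₁ : ℤ × ℤ → ℤ × ℤ by g₁(h, k) = (⌊h/2⌋ + ⌈k/2⌉, ⌊k/2⌋ + ⌈h/2⌉). For every h ∈ ℤ: if h is even, then g₁(h, h+1) = (h+1, h); if h is odd, then g₁(h, h+1) = (h, h+1). Consequently, the set R = {r ∈ ℤ^N : ∃ α ∈ ℤ, ∀ i, r_i ∈ {α, α+1}} is invariant: if n ∈ R and the coordinates at any pair (i, j) are replaced by g₁(n_i, n_j), the resulting vector is again in R. -/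
/-- The per-edge symbolic dynamics of the compensating gossip rule with
deterministic quantizer: `g₁(h, k) = (⌊h/2⌋ + ⌈k/2⌉, ⌊k/2⌋ + ⌈h/2⌉)`. -/
def g1 (p : ℤ × ℤ) : ℤ × ℤ :=
  (⌊(p.1 : ℚ) / 2⌋ + ⌈(p.2 : ℚ) / 2⌉, ⌊(p.2 : ℚ) / 2⌋ + ⌈(p.1 : ℚ) / 2⌉)

/-- `g1` in terms of integer division: `⌊h/2⌋ = h / 2` and `⌈h/2⌉ = (h + 1) / 2`. -/
theorem g1_eq_ediv (h k : ℤ) :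
    g1 (h, k) = (h / 2 + (k + 1) / 2, k / 2 + (h + 1) / 2) := by
  have floor_half (a : ℤ) : ⌊(a : ℚ) / 2⌋ = a / 2 := by
    exact_mod_cast Rat.floor_intCast_div_natCast a 2
  have ceil_half (a : ℤ) : ⌈(a : ℚ) / 2⌉ = (a + 1) / 2 := by
    have := floor_half (-a)
    rw [Int.cast_neg, neg_div, Int.floor_neg] at this
    omega
  simp only [g1, floor_half, ceil_half]

/-- `g₁` swaps `(h, h+1)` when `h` is even and fixes it when `h` is odd; consequently
the set `R = {r : ∃ α, ∀ i, r i ∈ {α, α+1}}` is invariant under applying `g₁` to any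
pair of coordinates. -/
theorem stmt_14 :
    (∀ h : ℤ, (Even h → g1 (h, h + 1) = (h + 1, h)) ∧
              (Odd h → g1 (h, h + 1) = (h, h + 1))) ∧
    (∀ (N : ℕ) (n : Fin N → ℤ),
      (∃ α : ℤ, ∀ i, n i = α ∨ n i = α + 1) →
      ∀ i j : Fin N, i ≠ j →
        ∃ α : ℤ, ∀ h : Fin N,
          Function.update (Function.update n i (g1 (n i, n j)).1) j (g1 (n i, n j)).2 h = α ∨
          Function.update (Function.update n i (g1 (n i, n j)).1) j (g1 (n i, n j)).2 h
            = α + 1) := by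
  refine ⟨fun h => ⟨?_, ?_⟩, ?_⟩
  · rintro ⟨m, rfl⟩
    rw [g1_eq_ediv, Prod.mk.injEq]
    omega
  · rintro ⟨m, rfl⟩
    rw [g1_eq_ediv, Prod.mk.injEq]
    omega
  · rintro N n ⟨α, hα⟩ i j -
    refine ⟨α, fun h => ?_⟩
    have hi := hα i
    have hj := hα j
    have hh := hα h
    simp only [g1_eq_ediv, Function.update_apply]
    split_ifs <;> omega
end

section
/- Let x, y ∈ ℝ and set q_d(z) = ⌊z + 1/2⌋, n = ⌊2x⌋, m = ⌊2y⌋. Then ⌊2·(x − (1/2)·q_d(x) + (1/2)·q_d(y))⌋ = ⌊n/2⌋ + ⌈m/2⌉, where ⌊n/2⌋ and ⌈m/2⌉ are the floor and ceiling of integer division by 2. -/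
/-- The rounding quantizer `⌊z + 1/2⌋` depends only on `⌊2z⌋`. -/
theorem floor_add_half_eq_ceil_floor_two_mul_div_two (z : ℝ) :
    ⌊z + 1/2⌋ = ⌈((⌊2 * z⌋ : ℤ) : ℚ) / 2⌉ := by
  have hlo := Int.floor_le (z + 1/2)
  have hhi := Int.lt_floor_add_one (z + 1/2)
  generalize ⌊z + 1/2⌋ = q at hlo hhi ⊢
  have hn : 2 * q - 1 ≤ ⌊2 * z⌋ := Int.le_floor.2 (by push_cast; linarith)
  have hn' : ⌊2 * z⌋ < 2 * q + 1 := Int.floor_lt.2 (by push_cast; linarith)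
  generalize ⌊2 * z⌋ = n at hn hn' ⊢
  have h : (2 * q - 1 : ℚ) ≤ n := by exact_mod_cast hn
  have h' : (n : ℚ) ≤ 2 * q := by exact_mod_cast Int.lt_add_one_iff.1 hn'
  rw [eq_comm, Int.ceil_eq_iff]
  constructor <;> linarith

theorem floor_div_two_eq_sub_ceil_div_two (n : ℤ) :
    ⌊(n : ℚ) / 2⌋ = n - ⌈(n : ℚ) / 2⌉ := by
  have h : (n : ℚ) / 2 = n - n / 2 := by ring
  rw [sub_eq_add_neg, ← Int.floor_neg, ← Int.floor_intCast_add, ← sub_eq_add_neg, ← h]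

/-- One step of the compensating gossip update `x ↦ x − (1/2)q_d(x) + (1/2)q_d(y)`,
with `q_d(z) = ⌊z + 1/2⌋`, induces the symbolic update `n ↦ ⌊n/2⌋ + ⌈m/2⌉` on
`n = ⌊2x⌋`, `m = ⌊2y⌋`. -/
theorem stmt_18 (x y : ℝ) :
    ⌊2 * (x - (1/2) * ((⌊x + 1/2⌋ : ℤ) : ℝ) + (1/2) * ((⌊y + 1/2⌋ : ℤ) : ℝ))⌋ =
      ⌊((⌊2 * x⌋ : ℤ) : ℚ) / 2⌋ + ⌈((⌊2 * y⌋ : ℤ) : ℚ) / 2⌉ := by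
  have h : 2 * (x - (1/2) * ((⌊x + 1/2⌋ : ℤ) : ℝ) + (1/2) * ((⌊y + 1/2⌋ : ℤ) : ℝ)) =
      2 * x - (⌊x + 1/2⌋ : ℤ) + (⌊y + 1/2⌋ : ℤ) := by ring
  rw [h, Int.floor_add_intCast, Int.floor_sub_intCast, floor_div_two_eq_sub_ceil_div_two,
    floor_add_half_eq_ceil_floor_two_mul_div_two x,
    floor_add_half_eq_ceil_floor_two_mul_div_two y]
end
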